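/- Let n ≥ 2 and k ≥ 2. If G is a group of permutations of ℚ^n that properly contains AGL_n(ℚ) and preserves a Steiner k-system on ℚ^n, then k > 2. -/

import Mathlib

/-- `σ` is an element of `AGL_n(ℚ)`: a permutation of `ℚ^n` of the form
`x ↦ T x + b` with `T` an invertible `ℚ`-linear map and `b ∈ ℚ^n`. -/
def IsAGL (n : ℕ) (σ : Equiv.Perm (Fin n → ℚ)) : Prop :=
  ∃ T : (Fin n → ℚ) ≃ₗ[ℚ] (Fin n → ℚ), ∃ b : Fin n → ℚ, ∀ x, σ x = T x + b

/-- `(X, B)` is a Steiner `k`-system: all blocks have the same cardinality,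
every block has more than `k` elements, there is more than one block, and any
`k` pairwise distinct points lie in a unique block. -/
def IsSteinerSystem {X : Type*} (k : ℕ) (B : Set (Set X)) : Prop :=
  (∀ b₁ ∈ B, ∀ b₂ ∈ B, Cardinal.mk b₁ = Cardinal.mk b₂) ∧
  (∀ b ∈ B, (k : Cardinal) < Cardinal.mk b) ∧
  (∃ b₁ ∈ B, ∃ b₂ ∈ B, b₁ ≠ b₂) ∧
  (∀ f : Fin k → X, Function.Injective f → ∃! b, b ∈ B ∧ ∀ i, f i ∈ b)

/-- A set of rationals containing at least three points, among them `0` and `1`, and stable under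
all affine maps of the line sending `0, 1` to two of its points, is everything. -/
theorem Rat.mem_of_affine_stable {S : Set ℚ} (h0 : (0 : ℚ) ∈ S) (h1 : (1 : ℚ) ∈ S)
    (hS : ∀ s ∈ S, ∀ s' ∈ S, s ≠ s' → ∀ t, t ∈ S ↔ s + (s' - s) * t ∈ S)
    {t : ℚ} (ht : t ∈ S) (ht0 : t ≠ 0) (ht1 : t ≠ 1) (q : ℚ) : q ∈ S := by
  have hdiv : ∀ x ∈ S, ∀ y ∈ S, x ≠ 0 → y / x ∈ S := fun x hx y hy hx0 => by
    rw [hS 0 h0 x hx hx0.symm]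
    convert hy using 1
    field_simp
    ring
  have hsub' : ∀ x ∈ S, ∀ y ∈ S, x ≠ 0 → x - y ∈ S := fun x hx y hy hx0 => by
    have := (hS x hx 0 h0 hx0 _).1 (hdiv x hx y hy hx0)
    convert this using 1
    field_simp
    ring
  have hneg1 : (-1 : ℚ) ∈ S := by
    have := hsub' (t - 1) (hsub' t ht 1 h1 ht0) t ht (sub_ne_zero.2 ht1)
    convert this using 1
    ring
  have hneg : ∀ y ∈ S, -y ∈ S := fun y hy => by
    have := hdiv (-1) hneg1 y hy (by norm_num)
    convert this using 1
    ring
  have hsub : ∀ x ∈ S, ∀ y ∈ S, x - y ∈ S := fun x hx y hy => by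
    by_cases hx0 : x = 0
    · simpa [hx0] using hneg y hy
    · exact hsub' x hx y hy hx0
  have hnat : ∀ m : ℕ, (m : ℚ) ∈ S := fun m => by
    induction m with
    | zero => simpa using h0
    | succ m ih => simpa using hsub _ ih _ hneg1
  have hint : ∀ m : ℤ, (m : ℚ) ∈ S := fun m => by
    obtain ⟨a, rfl | rfl⟩ := m.eq_nat_or_neg
    · simpa using hnat a
    · simpa using hneg _ (hnat a)
  rw [← Rat.num_div_den q]
  exact hdiv _ (hnat _) _ (hint _) (by exact_mod_cast q.den_nz)

section Blocks

variable {V : Type*} [AddCommGroup V] [Module ℚ V]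

/-- A linear map fixing the line `ℚ u` and sending `v` to `w`. -/
theorem exists_linearEquiv_fixing_of_dual [FiniteDimensional ℚ V] (f : V →ₗ[ℚ] ℚ) {u v w : V}
    (hu : f u = 0) (hv : f v ≠ 0) (hw : f w ≠ 0) :
    ∃ T : V ≃ₗ[ℚ] V, T u = u ∧ T v = w := by
  let A : V →ₗ[ℚ] V := LinearMap.id + f.smulRight ((f v)⁻¹ • (w - v))
  have hA : ∀ z, A z = z + f z • (f v)⁻¹ • (w - v) := fun z => rfl
  have hinj : Function.Injective A := by
    rw [← LinearMap.ker_eq_bot, LinearMap.ker_eq_bot']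
    intro z hz
    have hfz : f z = 0 := by
      have := congrArg f hz
      rw [hA] at this
      simp only [map_add, map_smul, map_sub, smul_eq_mul, map_zero] at this
      field_simp at this
      have h : f z * f w = 0 := by linarith
      exact (mul_eq_zero.1 h).resolve_right hw
    rw [hA, hfz] at hz
    simpa using hz
  refine ⟨LinearEquiv.ofInjectiveEndo A hinj, ?_, ?_⟩
  · simp [hA, hu]
  · simp [hA, hv]

/-- The blocks of an affine-invariant linear space structure on a `ℚ`-vector space are lines. -/
theorem eq_range_lineMap_of_block [FiniteDimensional ℚ V] {B : Set (Set V)}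
    (huniq : ∀ b ∈ B, ∀ b' ∈ B, ∀ x y, x ≠ y → x ∈ b → y ∈ b → x ∈ b' → y ∈ b' → b = b')
    (hthird : ∀ b ∈ B, ∀ x y, ∃ z ∈ b, z ≠ x ∧ z ≠ y)
    (hne : ∃ b₁ ∈ B, ∃ b₂ ∈ B, b₁ ≠ b₂)
    (hinv : ∀ (T : V ≃ₗ[ℚ] V) (c : V), ∀ b ∈ B, (fun p => T p + c) '' b ∈ B)
    {b : Set V} (hb : b ∈ B) {x y : V} (hxy : x ≠ y) (hx : x ∈ b) (hy : y ∈ b) :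
    b = Set.range (AffineMap.lineMap x y : ℚ → V) := by
  have hsub : ∀ z ∈ b, ∃ t : ℚ, AffineMap.lineMap x y t = z := by
    intro z hz
    by_contra! hoff
    have hnot : z - x ∉ Submodule.span ℚ {y - x} := by
      rw [Submodule.mem_span_singleton]
      rintro ⟨t, ht⟩
      apply hoff t
      rw [AffineMap.lineMap_apply_module', ht, sub_add_cancel]
    obtain ⟨f, hfz, hf⟩ := Submodule.exists_le_ker_of_notMem hnot
    have hfu : f (y - x) = 0 := hf (Submodule.mem_span_singleton_self _)
    have hmem : ∀ w, f w ≠ 0 → w + x ∈ b := by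
      intro w hw
      obtain ⟨T, hTu, hTv⟩ := exists_linearEquiv_fixing_of_dual f hfu hfz hw
      have himg := hinv T (x - T x) b hb
      have key : ∀ p ∈ b, T (p - x) + x ∈ (fun p => T p + (x - T x)) '' b := fun p hp =>
        ⟨p, hp, by simp only [map_sub]; abel⟩
      have heq := huniq _ himg _ hb x y hxy (by simpa using key x hx)
        (by simpa [hTu] using key y hy) hx hy
      rw [← heq, ← hTv]
      exact key z hz
    have huniv : ∀ p, p ∈ b := by
      intro p
      by_cases hp : f (p - x) = 0
      · have himg := hinv (LinearEquiv.refl ℚ V) (p - x) b hb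
        have key : ∀ w, f w ≠ 0 → w + x ∈ (fun q => (LinearEquiv.refl ℚ V) q + (p - x)) '' b :=
          fun w hw => ⟨(w - (p - x)) + x, hmem _ (by rw [map_sub, hp, sub_zero]; exact hw),
            by simp; abel⟩
        have h2 : f ((2 : ℚ) • (z - x)) ≠ 0 := by simpa using hfz
        have hdiff : (z - x) + x ≠ (2 : ℚ) • (z - x) + x := by
          intro h
          rw [two_smul, add_left_inj, left_eq_add] at h
          exact hfz (by rw [h, map_zero])
        rw [← huniq _ himg _ hb _ _ hdiff (key _ hfz) (key _ h2) (hmem _ hfz) (hmem _ h2)]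
        exact ⟨x, hx, by simp⟩
      · simpa using hmem _ hp
    have hall : ∀ b' ∈ B, b' = b := fun b' hb' => by
      obtain ⟨p, hp, -⟩ := hthird b' hb' x x
      obtain ⟨q, hq, hqp, -⟩ := hthird b' hb' p p
      exact huniq _ hb' _ hb q p hqp hq hp (huniv q) (huniv p)
    obtain ⟨b₁, hb₁, b₂, hb₂, h⟩ := hne
    exact h ((hall b₁ hb₁).trans (hall b₂ hb₂).symm)
  refine Set.Subset.antisymm (fun z hz => hsub z hz) ?_
  rintro _ ⟨q, rfl⟩
  obtain ⟨z, hz, hzx, hzy⟩ := hthird b hb x y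
  obtain ⟨t, rfl⟩ := hsub z hz
  refine Rat.mem_of_affine_stable (S := {s | AffineMap.lineMap x y s ∈ b}) (by simpa using hx)
    (by simpa using hy) ?_ hz (fun h => hzx (by simp [h])) (fun h => hzy (by simp [h])) q
  intro s hs s' hs' hss r
  have hc : s' - s ≠ 0 := sub_ne_zero.2 hss.symm
  have himg := hinv (LinearEquiv.smulOfNeZero ℚ V _ hc) (AffineMap.lineMap x y s - (s' - s) • x)
    b hb
  have hval : ∀ r : ℚ, (LinearEquiv.smulOfNeZero ℚ V _ hc) (AffineMap.lineMap x y r) +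
      (AffineMap.lineMap x y s - (s' - s) • x) = AffineMap.lineMap x y (s + (s' - s) * r) := by
    intro r
    simp only [LinearEquiv.smulOfNeZero_apply, AffineMap.lineMap_apply_module']
    module
  have heq := huniq _ himg _ hb (AffineMap.lineMap x y s) (AffineMap.lineMap x y s')
    (fun h => hss (AffineMap.lineMap_injective ℚ hxy h))
    ⟨x, hx, by simp⟩ ⟨y, hy, by simpa using hval 1⟩ hs hs'
  have hinj : Function.Injective (fun p => (LinearEquiv.smulOfNeZero ℚ V _ hc) p +
      (AffineMap.lineMap x y s - (s' - s) • x)) :=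
    (add_left_injective _).comp (LinearEquiv.injective _)
  have := hinj.mem_set_image (s := b) (a := AffineMap.lineMap x y r)
  rw [heq] at this
  simp only [hval] at this
  exact this.symm

/-- A collineation fixing the origin is additive on pairs of independent vectors. -/
theorem map_add_of_collineation_of_independent (σ : V ≃ V) (h0 : σ 0 = 0)
    (hline : ∀ x y, x ≠ y → σ '' Set.range (AffineMap.lineMap x y : ℚ → V) =
      Set.range (AffineMap.lineMap (σ x) (σ y) : ℚ → V))
    {x y : V} (hxy : ∀ c : ℚ, x ≠ c • y) (hyx : ∀ c : ℚ, y ≠ c • x) :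
    σ (x + y) = σ x + σ y := by
  have fwd : ∀ x y, x ≠ y → ∀ t : ℚ, ∃ s : ℚ,
      s • (σ y - σ x) + σ x = σ (t • (y - x) + x) := fun x y h t => by
    have : σ (AffineMap.lineMap x y t) ∈ σ '' Set.range (AffineMap.lineMap x y : ℚ → V) :=
      ⟨_, ⟨t, rfl⟩, rfl⟩
    rw [hline x y h] at this
    simpa only [Set.mem_range, AffineMap.lineMap_apply_module'] using this
  have bwd : ∀ x y, x ≠ y → ∀ s : ℚ, ∃ t : ℚ,
      σ (t • (y - x) + x) = s • (σ y - σ x) + σ x := fun x y h s => by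
    have : (AffineMap.lineMap (σ x) (σ y) s : V) ∈
      Set.range (AffineMap.lineMap (σ x) (σ y) : ℚ → V) := ⟨s, rfl⟩
    rw [← hline x y h] at this
    obtain ⟨_, ⟨t, rfl⟩, ht⟩ := this
    exact ⟨t, by simpa only [AffineMap.lineMap_apply_module'] using ht⟩
  have coeff : ∀ x y : V, (∀ c : ℚ, x ≠ c • y) → (∀ c : ℚ, y ≠ c • x) → ∀ p q : ℚ,
      σ (x + y) = p • σ x + q • σ y → p = 1 := by
    intro x y hxy hyx p q hpq
    by_contra hp
    have hy0 : y ≠ 0 := by simpa using hyx 0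
    have hp' : p - 1 ≠ 0 := sub_ne_zero.2 hp
    obtain ⟨t, ht⟩ := bwd x (x + y) (by simpa using hy0) (-(p - 1)⁻¹)
    obtain ⟨t', ht'⟩ := bwd 0 y hy0.symm (-(p - 1)⁻¹ * q)
    have h : σ (t • (x + y - x) + x) = σ (t' • (y - 0) + 0) := by
      rw [ht, ht', hpq, h0]
      match_scalars
      · field_simp
        ring
      · ring
    apply hxy (t' - t)
    have := σ.injective h
    simp only [add_sub_cancel_left, sub_zero, add_zero] at this
    rw [sub_smul, ← this, add_sub_cancel_left]
  have hx0 : x ≠ 0 := by simpa using hxy 0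
  have hy0 : y ≠ 0 := by simpa using hyx 0
  obtain ⟨a, ha⟩ := fwd 0 x hx0.symm 2
  obtain ⟨b, hb⟩ := fwd 0 y hy0.symm 2
  have h2 : (2 : ℚ) • x ≠ (2 : ℚ) • y := fun h => by
    have h' := smul_right_injective V (two_ne_zero' ℚ) h
    exact hxy 1 (by simpa using h')
  obtain ⟨s, hs⟩ := fwd _ _ h2 (1 / 2)
  simp only [h0, sub_zero, add_zero] at ha hb
  have hxy' : σ (x + y) = ((1 - s) * a) • σ x + (s * b) • σ y := by
    have : x + y = (1 / 2 : ℚ) • ((2 : ℚ) • y - (2 : ℚ) • x) + (2 : ℚ) • x := by module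
    rw [this, ← hs, ← ha, ← hb]
    module
  have hp := coeff x y hxy hyx _ _ hxy'
  have hq := coeff y x hyx hxy (s * b) ((1 - s) * a) (by rw [add_comm y, hxy', add_comm])
  rw [hxy', hp, hq, one_smul, one_smul]

/-- A collineation of dimension at least two fixing the origin is additive. -/
theorem map_add_of_collineation (σ : V ≃ V) (h0 : σ 0 = 0)
    (hdim : ∀ x : V, ∃ z, ∀ c : ℚ, z ≠ c • x)
    (hline : ∀ x y, x ≠ y → σ '' Set.range (AffineMap.lineMap x y : ℚ → V) =
      Set.range (AffineMap.lineMap (σ x) (σ y) : ℚ → V)) (x y : V) :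
    σ (x + y) = σ x + σ y := by
  have indep : ∀ x y : V, x ≠ 0 → (∀ c : ℚ, y ≠ c • x) → σ (x + y) = σ x + σ y := by
    intro x y hx hyx
    refine map_add_of_collineation_of_independent σ h0 hline (fun c hc => ?_) hyx
    have hc0 : c ≠ 0 := by
      rintro rfl
      exact hx (by simpa using hc)
    exact hyx c⁻¹ (by rw [hc, inv_smul_smul₀ hc0])
  by_cases hx : x = 0
  · simp [hx, h0]
  by_cases hyx : ∃ c : ℚ, y = c • x
  swap
  · exact indep x y hx (by simpa using hyx)
  obtain ⟨c, rfl⟩ := hyx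
  obtain ⟨z, hz⟩ := hdim x
  have h1 : σ (x + (c • x + z)) = σ x + σ (c • x + z) := by
    refine indep _ _ hx fun d hd => hz (d - c) ?_
    rw [sub_smul, ← hd, add_sub_cancel_left]
  have hmul : ∀ d : ℚ, σ (d • x + z) = σ (d • x) + σ z := by
    intro d
    by_cases hd : d • x = 0
    · simp [hd, h0]
    · refine indep _ _ hd fun e he => hz (e * d) ?_
      rw [he, mul_smul]
  have h2 : x + c • x = (1 + c) • x := by module
  have h3 : x + (c • x + z) = (1 + c) • x + z := by module
  rw [h3, hmul, hmul, ← add_assoc, add_left_inj] at h1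
  rw [h2, h1]

end Blocks

/-- In a rational affine space of dimension at least two, collineations are affine. -/
theorem isAGL_of_collineation {n : ℕ} (hn : 2 ≤ n) (σ : Equiv.Perm (Fin n → ℚ))
    (hline : ∀ x y, x ≠ y → σ '' Set.range (AffineMap.lineMap x y : ℚ → Fin n → ℚ) =
      Set.range (AffineMap.lineMap (σ x) (σ y) : ℚ → Fin n → ℚ)) : IsAGL n σ := by
  let τ : (Fin n → ℚ) ≃ (Fin n → ℚ) := σ.trans (Equiv.subRight (σ 0))
  have hτ : ∀ x, τ x = σ x - σ 0 := fun x => rfl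
  have hdim : ∀ x : Fin n → ℚ, ∃ z : Fin n → ℚ, ∀ c : ℚ, z ≠ c • x := by
    intro x
    have hlt : Submodule.span ℚ {x} < ⊤ := by
      apply Submodule.lt_top_of_finrank_lt_finrank
      have := finrank_span_le_card (R := ℚ) ({x} : Set (Fin n → ℚ))
      rw [Module.finrank_fin_fun]
      simp only [Set.toFinset_singleton, Finset.card_singleton] at this
      omega
    obtain ⟨z, -, hz⟩ := SetLike.exists_of_lt hlt
    exact ⟨z, fun c hc => hz (Submodule.mem_span_singleton.2 ⟨c, hc.symm⟩)⟩
  have hadd := map_add_of_collineation τ (by simp [hτ]) hdim fun x y hxy => by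
    have : (τ : (Fin n → ℚ) → Fin n → ℚ) = (fun p => p - σ 0) ∘ σ := rfl
    rw [this, Set.image_comp, hline x y hxy, ← Set.range_comp]
    congr 1
    ext1 t
    simp only [Function.comp_apply, AffineMap.lineMap_apply_module']
    module
  let T : (Fin n → ℚ) →ₗ[ℚ] (Fin n → ℚ) := (AddMonoidHom.mk' τ hadd).toRatLinearMap
  refine ⟨LinearEquiv.ofBijective T τ.bijective, σ 0, fun x => ?_⟩
  change σ x = τ x + σ 0
  rw [hτ, sub_add_cancel]

/-- In a Steiner `k`-system with `k ≥ 2`, no block is contained in a pair. -/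
theorem IsSteinerSystem.exists_third {X : Type*} {k : ℕ} (hk : 2 ≤ k) {B : Set (Set X)}
    (hB : IsSteinerSystem k B) {b : Set X} (hb : b ∈ B) (x y : X) : ∃ z ∈ b, z ≠ x ∧ z ≠ y := by
  by_contra! h
  have hsub : b ⊆ {x, y} := fun z hz => by
    by_cases hzx : z = x
    · exact Or.inl hzx
    · exact Or.inr (h z hz hzx)
  have h1 := (hB.2.1 b hb).trans_le (Cardinal.mk_le_mk_of_subset hsub)
  have h2 : Cardinal.mk ({x, y} : Set X) ≤ 2 := by
    refine Cardinal.mk_insert_le.trans ?_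
    rw [Cardinal.mk_singleton, one_add_one_eq_two]
  exact absurd (h1.trans_le h2) (not_lt.2 (by exact_mod_cast hk))

/-- In a Steiner `2`-system, two distinct points lie in exactly one block. -/
theorem IsSteinerSystem.existsUnique_block {X : Type*} {B : Set (Set X)}
    (hB : IsSteinerSystem 2 B) {x y : X} (hxy : x ≠ y) : ∃! b, b ∈ B ∧ x ∈ b ∧ y ∈ b := by
  have hinj : Function.Injective ![x, y] := by
    intro i j
    fin_cases i <;> fin_cases j <;> simp [hxy, hxy.symm]
  simpa [Fin.forall_fin_two] using hB.2.2.2 ![x, y] hinj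

/-- If a group of permutations of `ℚ^n` (`n ≥ 2`) properly containing `AGL_n(ℚ)`
preserves a Steiner `k`-system (`k ≥ 2`) on `ℚ^n`, then `k > 2`. -/
theorem steiner_system_of_proper_supergroup_k_gt_two (n k : ℕ) (hn : 2 ≤ n) (hk : 2 ≤ k)
    (G : Subgroup (Equiv.Perm (Fin n → ℚ)))
    (hsub : ∀ σ : Equiv.Perm (Fin n → ℚ), IsAGL n σ → σ ∈ G)
    (hproper : ∃ σ ∈ G, ¬ IsAGL n σ)
    (B : Set (Set (Fin n → ℚ))) (hB : IsSteinerSystem k B)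
    (hpres : ∀ σ ∈ G, ∀ b ∈ B, (σ : Equiv.Perm (Fin n → ℚ)) '' b ∈ B) :
    2 < k := by
  by_contra hk2
  obtain rfl : k = 2 := by omega
  obtain ⟨σ, hσG, hσ⟩ := hproper
  refine hσ (isAGL_of_collineation hn σ fun x y hxy => ?_)
  have hblock : ∀ b ∈ B, ∀ x y, x ≠ y → x ∈ b → y ∈ b →
      b = Set.range (AffineMap.lineMap x y : ℚ → Fin n → ℚ) := fun b hb x y hxy hx hy =>
    eq_range_lineMap_of_block
      (fun b hb b' hb' x y hxy hx hy hx' hy' =>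
        (hB.existsUnique_block hxy).unique ⟨hb, hx, hy⟩ ⟨hb', hx', hy'⟩)
      (fun b hb => hB.exists_third hk hb) hB.2.2.1
      (fun T c b hb => hpres (T.toEquiv.trans (Equiv.addRight c))
        (hsub _ ⟨T, c, fun _ => rfl⟩) b hb) hb hxy hx hy
  obtain ⟨b, ⟨hb, hx, hy⟩, -⟩ := hB.existsUnique_block hxy
  rw [← hblock b hb x y hxy hx hy]
  exact hblock _ (hpres σ hσG b hb) _ _ (σ.injective.ne hxy) (Set.mem_image_of_mem σ hx)
    (Set.mem_image_of_mem σ hy)
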